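/- Theorem III (type II-AEE suspensions are flexible): Under the Type II-AEE edge conditions, with signs satisfying s_{k+M} = −s_{M−k+1} for k = 1,…,M−1 (and θ_1 = 0), one has θ_{k+M} = θ_{M−k+2} for k = 2,…,M; consequently v_{k+M} = S v_{M−k+2} for k = 2,…,M, where S(x, y, z) = (x, y, −z), while S v_1 = v_1, S v_{M+1} = v_{M+1} and S u = w. In particular |v_N − v_1| = |v_2 − v_1| = L_1 = L_N for every admissible z, so all 3N edge lengths of the suspension are constant in the flexion parameter z. -/

import Mathlib

open Real

theorem cos_sign_mul_arccos {s t : ℝ} (hs : s = 1 ∨ s = -1) (ht : |t| ≤ 1) :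
    cos (s * arccos t) = t := by
  obtain ⟨h₁, h₂⟩ := abs_le.1 ht
  rcases hs with rfl | rfl <;> simp [cos_arccos h₁ h₂]

theorem EuclideanSpace.dist_eq_sqrt_fin_three (x y : EuclideanSpace ℝ (Fin 3)) :
    dist x y = √((x 0 - y 0) ^ 2 + (x 1 - y 1) ^ 2 + (x 2 - y 2) ^ 2) := by
  simp [EuclideanSpace.dist_eq, Fin.sum_univ_three, Real.dist_eq, sq_abs]

/-- If the increments of `θ` around `c` are antisymmetric up to distance `n`, then `θ` is symmetric
about `c` up to distance `n`. -/
theorem eq_reflect_of_antisymm_increments {θ d : ℕ → ℝ} {c n : ℕ} (hn : n ≤ c)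
    (hθ : ∀ k, c - n ≤ k → k < c + n → θ (k + 1) = θ k + d k)
    (hd : ∀ j < n, d (c + j) = -d (c - 1 - j)) {j : ℕ} (hj : j ≤ n) :
    θ (c + j) = θ (c - j) := by
  induction j with
  | zero => rfl
  | succ j ih =>
    have h₁ := hθ (c + j) (by omega) (by omega)
    have h₂ := hθ (c - 1 - j) (by omega) (by omega)
    rw [show c - 1 - j + 1 = c - j by omega] at h₂
    rw [← add_assoc, show c - (j + 1) = c - 1 - j by omega, h₁, ih (by omega), h₂,
      hd j (by omega)]
    ring

theorem suspension_theorem_III_II_AEE_flexible_stmt_8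
    (N M : ℕ) (hM : 3 ≤ M) (hNM : N = 2 * M)
    (z : ℝ) (hz : 0 < z)
    (l m L : ℕ → ℝ)
    (hl : ∀ k, 1 ≤ k → k ≤ N → 0 < l k)
    (hm : ∀ k, 1 ≤ k → k ≤ N → 0 < m k)
    (hL : ∀ k, 1 ≤ k → k ≤ N → 0 ≤ L k)
    (zc r t θ s : ℕ → ℝ)
    (hzc : ∀ k, 1 ≤ k → k ≤ N → zc k = (m k ^ 2 - l k ^ 2) / (2 * z))
    (hrad : ∀ k, 1 ≤ k → k ≤ N →
      0 < (m k ^ 2 + l k ^ 2) / 2 - zc k ^ 2 - z ^ 2 / 4)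
    (hr : ∀ k, 1 ≤ k → k ≤ N →
      r k = Real.sqrt ((m k ^ 2 + l k ^ 2) / 2 - zc k ^ 2 - z ^ 2 / 4))
    (ht : ∀ k, 1 ≤ k → k ≤ N - 1 →
      t k = (r (k + 1) ^ 2 + r k ^ 2 - L k ^ 2 + (zc (k + 1) - zc k) ^ 2) /
        (2 * r k * r (k + 1)))
    (hs : ∀ k, s k = 1 ∨ s k = -1)
    (htb : ∀ k, 1 ≤ k → k ≤ N - 1 → |t k| ≤ 1)
    (hθ : ∀ k, 1 ≤ k → k ≤ N - 1 → θ (k + 1) = θ k + s k * Real.arccos (t k))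
    (u w : EuclideanSpace ℝ (Fin 3)) (v : ℕ → EuclideanSpace ℝ (Fin 3))
    (hu : u 0 = 0 ∧ u 1 = 0 ∧ u 2 = z / 2)
    (hw : w 0 = 0 ∧ w 1 = 0 ∧ w 2 = -z / 2)
    (hv : ∀ k, 1 ≤ k → k ≤ N →
      v k 0 = r k * Real.cos (θ k) ∧ v k 1 = r k * Real.sin (θ k) ∧ v k 2 = zc k)
    (hAEE1 : m 1 = l 1)
    (hAEE2 : ∀ k, 2 ≤ k → k ≤ N → m k = l (N - k + 2))
    (hAEE3 : ∀ k, 1 ≤ k → k ≤ M → L (k + M) = L (M - k + 1))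
    (hsgn : ∀ k, 1 ≤ k → k ≤ M - 1 → s (k + M) = -s (M - k + 1))
    (hθ₁ : θ 1 = 0) :
    (∀ k, 2 ≤ k → k ≤ M → θ (k + M) = θ (M - k + 2)) ∧
      (∀ k, 2 ≤ k → k ≤ M →
        v (k + M) 0 = v (M - k + 2) 0 ∧ v (k + M) 1 = v (M - k + 2) 1 ∧
          v (k + M) 2 = -(v (M - k + 2) 2)) ∧
      v 1 2 = 0 ∧ v (M + 1) 2 = 0 ∧
      (w 0 = u 0 ∧ w 1 = u 1 ∧ w 2 = -(u 2)) ∧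
      dist (v N) (v 1) = dist (v 2) (v 1) ∧ dist (v 2) (v 1) = L 1 ∧ L 1 = L N := by
  subst hNM
  have hml : ∀ k, 2 ≤ k → k ≤ 2 * M → l k = m (2 * M - k + 2) := fun k h₁ h₂ ↦ by
    rw [hAEE2 _ (by omega) (by omega), show 2 * M - (2 * M - k + 2) + 2 = k by omega]
  have hzc_refl : ∀ k, 2 ≤ k → k ≤ 2 * M → zc (2 * M - k + 2) = -zc k := fun k h₁ h₂ ↦ by
    rw [hzc _ (by omega) (by omega), hzc k (by omega) h₂, ← hml k h₁ h₂, ← hAEE2 k h₁ h₂]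
    ring
  have hr_refl : ∀ k, 2 ≤ k → k ≤ 2 * M → r (2 * M - k + 2) = r k := fun k h₁ h₂ ↦ by
    rw [hr _ (by omega) (by omega), hr k (by omega) h₂, ← hml k h₁ h₂, ← hAEE2 k h₁ h₂,
      hzc_refl k h₁ h₂]
    ring_nf
  have ht_refl : ∀ j < M - 1, t (M + 1 + j) = t (M - j) := fun j hj ↦ by
    have hL_refl := hAEE3 (j + 1) (by omega) (by omega)
    rw [show j + 1 + M = M + 1 + j by omega, show M - (j + 1) + 1 = M - j by omega] at hL_refl
    have hz₁ := hzc_refl (M - j) (by omega) (by omega)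
    have hr₁ := hr_refl (M - j) (by omega) (by omega)
    have hz₂ := hzc_refl (M - j + 1) (by omega) (by omega)
    have hr₂ := hr_refl (M - j + 1) (by omega) (by omega)
    rw [show 2 * M - (M - j) + 2 = M + 1 + j + 1 by omega] at hz₁ hr₁
    rw [show 2 * M - (M - j + 1) + 2 = M + 1 + j by omega] at hz₂ hr₂
    rw [ht _ (by omega) (by omega), ht (M - j) (by omega) (by omega), hL_refl, hz₁, hz₂, hr₁, hr₂]
    ring
  have hθ_refl : ∀ k, 2 ≤ k → k ≤ M → θ (k + M) = θ (M - k + 2) := fun k h₁ h₂ ↦ by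
    have h := eq_reflect_of_antisymm_increments (θ := θ) (d := fun k ↦ s k * arccos (t k))
      (c := M + 1) (n := M - 1) (by omega) (fun i hi hi' ↦ hθ i (by omega) (by omega))
      (fun j hj ↦ by
        have hsj := hsgn (j + 1) (by omega) (by omega)
        rw [show j + 1 + M = M + 1 + j by omega, show M - (j + 1) + 1 = M - j by omega] at hsj
        simp only [Nat.add_sub_cancel, ht_refl j hj, hsj]
        ring) (j := k - 1) (by omega)
    rwa [show M + 1 + (k - 1) = k + M by omega, show M + 1 - (k - 1) = M - k + 2 by omega] at h
  have hv_refl : ∀ k, 2 ≤ k → k ≤ M →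
      v (k + M) 0 = v (M - k + 2) 0 ∧ v (k + M) 1 = v (M - k + 2) 1 ∧
        v (k + M) 2 = -(v (M - k + 2) 2) := fun k h₁ h₂ ↦ by
    obtain ⟨hx, hy, hz'⟩ := hv (k + M) (by omega) (by omega)
    obtain ⟨hx', hy', hz''⟩ := hv (M - k + 2) (by omega) (by omega)
    have hzk := hzc_refl (M - k + 2) (by omega) (by omega)
    have hrk := hr_refl (M - k + 2) (by omega) (by omega)
    rw [show 2 * M - (M - k + 2) + 2 = k + M by omega] at hzk hrk
    rw [hx, hy, hz', hx', hy', hz'', hzk, hrk, hθ_refl k h₁ h₂]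
    exact ⟨rfl, rfl, rfl⟩
  have hzc₁ : zc 1 = 0 := by simp [hzc 1 le_rfl (by omega), hAEE1]
  obtain ⟨hx₁, hy₁, hz₁⟩ := hv 1 le_rfl (by omega)
  obtain ⟨hx₂, hy₂, hz₂⟩ := hv 2 (by omega) (by omega)
  refine ⟨hθ_refl, hv_refl, hz₁.trans hzc₁, ?_, ?_, ?_, ?_, ?_⟩
  · have h := hzc_refl (M + 1) (by omega) (by omega)
    rw [show 2 * M - (M + 1) + 2 = M + 1 by omega] at h
    rw [(hv (M + 1) (by omega) (by omega)).2.2]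
    linarith
  · obtain ⟨hu₀, hu₁, hu₂⟩ := hu
    obtain ⟨hw₀, hw₁, hw₂⟩ := hw
    exact ⟨hw₀.trans hu₀.symm, hw₁.trans hu₁.symm, by rw [hw₂, hu₂]; ring⟩
  · obtain ⟨hx, hy, hz'⟩ := hv_refl M (by omega) le_rfl
    rw [← two_mul, Nat.sub_self, zero_add] at hx hy hz'
    rw [EuclideanSpace.dist_eq_sqrt_fin_three, EuclideanSpace.dist_eq_sqrt_fin_three, hx, hy, hz',
      hz₁, hzc₁]
    ring_nf
  · have hr_pos : ∀ k, 1 ≤ k → k ≤ 2 * M → 0 < r k := fun k h₁ h₂ ↦ by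
      rw [hr k h₁ h₂]
      exact Real.sqrt_pos.2 (hrad k h₁ h₂)
    have hr₁ := (hr_pos 1 le_rfl (by omega)).ne'
    have hr₂ := (hr_pos 2 (by omega) (by omega)).ne'
    have hcos : cos (θ 2) = t 1 := by
      rw [hθ 1 le_rfl (by omega), hθ₁, zero_add,
        cos_sign_mul_arccos (hs 1) (htb 1 le_rfl (by omega))]
    have ht₁ : t 1 * (2 * r 1 * r 2) = r 2 ^ 2 + r 1 ^ 2 - L 1 ^ 2 + (zc 2 - zc 1) ^ 2 := by
      rw [ht 1 le_rfl (by omega)]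
      field_simp
    rw [EuclideanSpace.dist_eq_sqrt_fin_three, hx₁, hy₁, hz₁, hx₂, hy₂, hz₂, hθ₁, cos_zero,
      sin_zero, ← Real.sqrt_sq (hL 1 le_rfl (by omega))]
    congr 1
    rw [← hcos] at ht₁
    linear_combination r 2 ^ 2 * sin_sq_add_cos_sq (θ 2) - ht₁
  · have h := hAEE3 M (by omega) le_rfl
    rw [Nat.sub_self, zero_add, ← two_mul] at h
    exact h.symm
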